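/- Let α ∈ (0,1), T > 0, and let ψ be a nonnegative integrable function on [0,T]. Suppose there exist constants ψ₀ ≥ 0 and N₁ ≥ 0 such that ψ(t) ≤ ψ₀ + N₁ I^α ψ(t) for all t ∈ [0,T], where I^α is the Riemann–Liouville fractional integral. Then ψ(t) ≤ (1 + Σ_{k=1}^∞ (N₁^k / Γ(kα)) · (Γ(α) t^α)^k / (kα)) ψ₀ for all t ∈ [0,T]. -/

import Mathlib

open MeasureTheory Set

/-- Riemann–Liouville fractional integral of order `α`. -/
noncomputable def rlIntegral (α : ℝ) (φ : ℝ → ℝ) (t : ℝ) : ℝ :=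
  (Real.Gamma α)⁻¹ * ∫ s in Ioo (0 : ℝ) t, (t - s) ^ (α - 1) * φ s

open scoped ENNReal

/-- The normalized power kernel `u ↦ u ^ (p - 1) / Γ(p)` on the positive half-line,
extended by zero. -/
noncomputable def powerKernel (p : ℝ) : ℝ → ℝ≥0∞ :=
  (Ioi (0 : ℝ)).indicator fun u => ENNReal.ofReal (u ^ (p - 1) / Real.Gamma p)

lemma powerKernel_of_pos {p u : ℝ} (hu : 0 < u) :
    powerKernel p u = ENNReal.ofReal (u ^ (p - 1) / Real.Gamma p) :=
  indicator_of_mem (mem_Ioi.2 hu) _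

lemma powerKernel_of_nonpos {p u : ℝ} (hu : u ≤ 0) : powerKernel p u = 0 :=
  indicator_of_notMem (notMem_Ioi.2 hu) _

lemma measurable_powerKernel (p : ℝ) : Measurable (powerKernel p) := by
  unfold powerKernel
  exact Measurable.indicator (by fun_prop) measurableSet_Ioi

lemma integral_rpow_mul_sub_rpow {p q t : ℝ} (hp : 0 < p) (hq : 0 < q) (ht : 0 < t) :
    ∫ s in Ioo 0 t, (t - s) ^ (p - 1) * s ^ (q - 1) =
      t ^ (p + q - 1) * (Real.Gamma p * Real.Gamma q / Real.Gamma (p + q)) := by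
  have h1 := Complex.betaIntegral_scaled (q : ℂ) (p : ℂ) ht
  have hb : Complex.betaIntegral q p =
      ((Real.Gamma p * Real.Gamma q / Real.Gamma (p + q) : ℝ) : ℂ) := by
    rw [Complex.betaIntegral_eq_Gamma_mul_div _ _ (by simpa) (by simpa)]
    rw [← Complex.ofReal_add, Complex.Gamma_ofReal, Complex.Gamma_ofReal, Complex.Gamma_ofReal,
      add_comm q p]
    push_cast
    ring
  rw [hb, intervalIntegral.integral_of_le ht.le, integral_Ioc_eq_integral_Ioo] at h1
  have h2 : (t : ℂ) ^ ((q : ℂ) + p - 1) = ((t ^ (p + q - 1) : ℝ) : ℂ) := by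
    rw [Complex.ofReal_cpow ht.le]
    push_cast
    ring_nf
  rw [h2, ← Complex.ofReal_mul] at h1
  rw [← Complex.ofReal_inj, ← h1, ← integral_complex_ofReal]
  refine setIntegral_congr_fun measurableSet_Ioo fun s hs => ?_
  simp only [Complex.ofReal_mul]
  rw [Complex.ofReal_cpow hs.1.le, Complex.ofReal_cpow (sub_nonneg.2 hs.2.le)]
  push_cast
  ring

lemma lintegral_powerKernel_mul_powerKernel {p q : ℝ} (hp : 0 < p) (hq : 0 < q) (t : ℝ) :
    ∫⁻ s, powerKernel p (t - s) * powerKernel q s = powerKernel (p + q) t := by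
  have hΓp := Real.Gamma_pos_of_pos hp
  have hΓq := Real.Gamma_pos_of_pos hq
  have hΓ := Real.Gamma_pos_of_pos (add_pos hp hq)
  have hind : (fun s => powerKernel p (t - s) * powerKernel q s) =
      (Ioo 0 t).indicator fun s => ENNReal.ofReal
        ((Real.Gamma p * Real.Gamma q)⁻¹ * ((t - s) ^ (p - 1) * s ^ (q - 1))) := by
    ext s
    by_cases hs : s ∈ Ioo 0 t
    · have h1 := hs.1
      have h2 := sub_pos.2 hs.2
      rw [indicator_of_mem hs, powerKernel_of_pos h1, powerKernel_of_pos h2,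
        ← ENNReal.ofReal_mul (by positivity)]
      congr 1
      field_simp
    · rw [indicator_of_notMem hs]
      rcases le_or_gt s 0 with h | h
      · rw [powerKernel_of_nonpos h, mul_zero]
      · rw [powerKernel_of_nonpos (sub_nonpos.2 (not_lt.1 fun h' => hs ⟨h, h'⟩)), zero_mul]
  rw [hind, lintegral_indicator measurableSet_Ioo]
  rcases le_or_gt t 0 with ht | ht
  · simp [Ioo_eq_empty_of_le ht, powerKernel_of_nonpos ht]
  · have hI := integral_rpow_mul_sub_rpow hp hq ht
    have hint : IntegrableOn (fun s => (t - s) ^ (p - 1) * s ^ (q - 1)) (Ioo 0 t) :=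
      .of_integral_ne_zero (by rw [hI]; positivity)
    rw [← ofReal_integral_eq_lintegral_ofReal (hint.const_mul _), integral_const_mul, hI,
      powerKernel_of_pos ht]
    · congr 1
      field_simp
    · filter_upwards [ae_restrict_mem measurableSet_Ioo] with s hs
      have h1 := hs.1
      have h2 := sub_pos.2 hs.2
      simp only [Pi.zero_apply]
      positivity

lemma lintegral_exp_neg_mul_powerKernel {p r : ℝ} (hp : 0 < p) (hr : 0 < r) :
    ∫⁻ u, ENNReal.ofReal (Real.exp (-(r * u))) * powerKernel p u =
      ENNReal.ofReal ((1 / r) ^ p) := by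
  have hΓ := Real.Gamma_pos_of_pos hp
  have hind : (fun u => ENNReal.ofReal (Real.exp (-(r * u))) * powerKernel p u) =
      (Ioi 0).indicator fun u => ENNReal.ofReal
        ((Real.Gamma p)⁻¹ * (u ^ (p - 1) * Real.exp (-(r * u)))) := by
    ext u
    by_cases hu : u ∈ Ioi (0 : ℝ)
    · rw [indicator_of_mem hu, powerKernel_of_pos hu, ← ENNReal.ofReal_mul (by positivity)]
      congr 1
      field_simp
    · rw [indicator_of_notMem hu, powerKernel_of_nonpos (not_lt.1 hu), mul_zero]
  have hI := Real.integral_rpow_mul_exp_neg_mul_Ioi hp hr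
  have hint : IntegrableOn (fun u => u ^ (p - 1) * Real.exp (-(r * u))) (Ioi 0) :=
    .of_integral_ne_zero (by rw [hI]; positivity)
  rw [hind, lintegral_indicator measurableSet_Ioi,
    ← ofReal_integral_eq_lintegral_ofReal (hint.const_mul _), integral_const_mul, hI]
  · congr 1
    field_simp
  · filter_upwards [ae_restrict_mem measurableSet_Ioi] with u hu
    have h1 : (0 : ℝ) < u := hu
    simp only [Pi.zero_apply]
    positivity

/-- An integrable function dominated by a multiple of its own fractional integral vanishes. The
exponentially weighted `L¹` norm makes the fractional integral a contraction. -/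
lemma eq_zero_of_le_mul_lintegral_powerKernel {α b : ℝ} (hα : 0 < α) (hb : 0 ≤ b)
    {h : ℝ → ℝ≥0∞} (hm : AEMeasurable h) (hsupp : ∀ t ≤ 0, h t = 0) (hfin : ∫⁻ t, h t ≠ ∞)
    (hle : ∀ t, h t ≤ ENNReal.ofReal b * ∫⁻ s, powerKernel α (t - s) * h s) (t : ℝ) :
    h t = 0 := by
  have hbpos : 0 < 2 * (b + 1) := by linarith
  set r : ℝ := (2 * (b + 1)) ^ (1 / α) with hr
  have hrpos : 0 < r := Real.rpow_pos_of_pos hbpos _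
  have hrα : (1 / r) ^ α = (2 * (b + 1))⁻¹ := by
    rw [one_div, Real.inv_rpow hrpos.le, hr, ← Real.rpow_mul hbpos.le,
      one_div_mul_cancel hα.ne', Real.rpow_one]
  set e : ℝ → ℝ≥0∞ := fun u => ENNReal.ofReal (Real.exp (-(r * u))) with he
  have hem : Measurable e := by fun_prop
  have hemul (u v : ℝ) : e (u + v) = e u * e v := by
    simp only [he]
    rw [← ENNReal.ofReal_mul (by positivity), ← Real.exp_add]
    ring_nf
  have hgm := measurable_powerKernel α
  have hI_fin : ∫⁻ t, e t * h t ≠ ∞ := by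
    refine ne_top_of_le_ne_top hfin (lintegral_mono fun u => ?_)
    rcases le_or_gt u 0 with hu | hu
    · simp [hsupp u hu]
    · refine mul_le_of_le_one_left' (ENNReal.ofReal_le_one.2 (Real.exp_le_one_iff.2 ?_))
      have := mul_pos hrpos hu
      linarith
  have hI_le : ∫⁻ t, e t * h t ≤
      ENNReal.ofReal b * ENNReal.ofReal (2 * (b + 1))⁻¹ * ∫⁻ t, e t * h t :=
    calc ∫⁻ t, e t * h t
        ≤ ∫⁻ t, ENNReal.ofReal b * ∫⁻ s, e (t - s) * powerKernel α (t - s) * (e s * h s) := by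
          refine lintegral_mono fun u => ?_
          calc e u * h u
              ≤ e u * (ENNReal.ofReal b * ∫⁻ s, powerKernel α (u - s) * h s) := by
                gcongr; exact hle u
            _ = ENNReal.ofReal b * ∫⁻ s, e (u - s) * powerKernel α (u - s) * (e s * h s) := by
                rw [mul_left_comm, ← lintegral_const_mul' _ _ ENNReal.ofReal_ne_top]
                congr 2
                ext s
                change e u * _ = _
                rw [show e u = e (u - s) * e s by rw [← hemul, sub_add_cancel]]
                ring
      _ = ENNReal.ofReal b * ∫⁻ s, ∫⁻ t, e (t - s) * powerKernel α (t - s) * (e s * h s) := by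
          rw [lintegral_const_mul' _ _ ENNReal.ofReal_ne_top, lintegral_lintegral_swap]
          have hk : Measurable fun x : ℝ × ℝ =>
              e (x.1 - x.2) * powerKernel α (x.1 - x.2) := by fun_prop
          have hs : AEMeasurable (fun s => e s * h s) := hem.aemeasurable.mul hm
          exact hk.aemeasurable.mul hs.comp_snd
      _ = ENNReal.ofReal b * ENNReal.ofReal (2 * (b + 1))⁻¹ * ∫⁻ t, e t * h t := by
          rw [mul_assoc]
          congr 1
          rw [← lintegral_const_mul' _ _ ENNReal.ofReal_ne_top]
          congr 1
          ext s
          rw [lintegral_mul_const _ (by fun_prop),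
            lintegral_sub_right_eq_self (fun u => e u * powerKernel α u) s,
            lintegral_exp_neg_mul_powerKernel hα hrpos, hrα]
  have hI : ∫⁻ t, e t * h t = 0 := by
    by_contra hne
    have hlt : ENNReal.ofReal b * ENNReal.ofReal (2 * (b + 1))⁻¹ < 1 := by
      rw [← ENNReal.ofReal_mul hb, ENNReal.ofReal_lt_one, ← div_eq_mul_inv, div_lt_one hbpos]
      linarith
    have := ENNReal.mul_lt_mul_left hne hI_fin hlt
    rw [one_mul] at this
    exact absurd hI_le (not_le.2 this)
  have hae : h =ᵐ[volume] 0 := by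
    have := (lintegral_eq_zero_iff' (hem.aemeasurable.mul hm)).1 hI
    filter_upwards [this] with u hu
    exact (mul_eq_zero.1 hu).resolve_left (ENNReal.ofReal_pos.2 (Real.exp_pos _)).ne'
  refine le_antisymm ((hle t).trans_eq ?_) zero_le
  rw [lintegral_congr_ae (g := fun _ => 0), lintegral_zero, mul_zero]
  filter_upwards [hae] with s hs
  simp [hs]

/-- The Mittag-Leffler function `t ↦ E_α(b t ^ α)` on the positive half-line. -/
noncomputable def mittagLefflerKernel (α b t : ℝ) : ℝ≥0∞ :=
  ∑' k : ℕ, ENNReal.ofReal (b ^ k) * powerKernel (k * α + 1) t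

lemma measurable_mittagLefflerKernel (α b : ℝ) : Measurable (mittagLefflerKernel α b) :=
  Measurable.tsum fun _ => (measurable_powerKernel _).const_mul _

lemma mul_lintegral_powerKernel_mul_pow {α b : ℝ} (hα : 0 < α) (hb : 0 ≤ b) (t : ℝ) (k : ℕ) :
    ENNReal.ofReal b * ∫⁻ s, powerKernel α (t - s) *
      (ENNReal.ofReal (b ^ k) * powerKernel (k * α + 1) s) =
      ENNReal.ofReal (b ^ (k + 1)) * powerKernel ((k + 1 : ℕ) * α + 1) t := by
  have hq : 0 < k * α + 1 := by positivity
  have hexp : α + (k * α + 1) = (k + 1 : ℕ) * α + 1 := by push_cast; ring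
  simp_rw [mul_left_comm (powerKernel α _)]
  rw [lintegral_const_mul' _ _ ENNReal.ofReal_ne_top,
    lintegral_powerKernel_mul_powerKernel hα hq, ← mul_assoc,
    ← ENNReal.ofReal_mul hb, ← pow_succ', hexp]

lemma mittagLefflerKernel_eq {α b : ℝ} (hα : 0 < α) (hb : 0 ≤ b) {t : ℝ} (ht : 0 < t) :
    mittagLefflerKernel α b t =
      1 + ENNReal.ofReal b * ∫⁻ s, powerKernel α (t - s) * mittagLefflerKernel α b s := by
  have hm := measurable_powerKernel
  have hsum : ∫⁻ s, powerKernel α (t - s) * mittagLefflerKernel α b s =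
      ∑' k : ℕ, ∫⁻ s, powerKernel α (t - s) *
        (ENNReal.ofReal (b ^ k) * powerKernel (k * α + 1) s) := by
    rw [← lintegral_tsum fun k => by fun_prop]
    simp_rw [ENNReal.tsum_mul_left, mittagLefflerKernel]
  rw [hsum, ← ENNReal.tsum_mul_left, tsum_congr (mul_lintegral_powerKernel_mul_pow hα hb t),
    mittagLefflerKernel, tsum_eq_zero_add' ENNReal.summable]
  congr 1
  simp [powerKernel_of_pos ht]

lemma rpow_mul_exp_neg_le_Gamma {x A : ℝ} (hx : 0 ≤ x) (hA : 0 < A) :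
    A ^ x * Real.exp (-A) ≤ Real.Gamma (x + 1) := by
  have hint := Real.GammaIntegral_convergent (s := x + 1) (by linarith)
  rw [Real.Gamma_eq_integral (by linarith), ← integral_exp_neg_Ioi, ← integral_const_mul]
  refine (setIntegral_mono_on ((integrableOn_exp_neg_Ioi A).const_mul _)
    (hint.mono_set (Ioi_subset_Ioi hA.le)) measurableSet_Ioi fun u hu => ?_).trans
    (setIntegral_mono_set hint ?_ (Ioi_subset_Ioi hA.le).eventuallyLE)
  · rw [mul_comm, add_sub_cancel_right]
    gcongr
    exact hu.le
  · filter_upwards [ae_restrict_mem measurableSet_Ioi] with u hu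
    have h1 : (0 : ℝ) < u := hu
    simp only [Pi.zero_apply]
    positivity

lemma summable_pow_div_Gamma {α x : ℝ} (hα : 0 < α) (hx : 0 ≤ x) :
    Summable fun k : ℕ => x ^ k / Real.Gamma (k * α + 1) := by
  have hpos : 0 < 2 * (x + 1) := by linarith
  set A : ℝ := (2 * (x + 1)) ^ (1 / α) with hA
  have hApos : 0 < A := Real.rpow_pos_of_pos hpos _
  have hAk (k : ℕ) : A ^ (k * α) = (2 * (x + 1)) ^ k := by
    rw [hA, ← Real.rpow_mul hpos.le, ← Real.rpow_natCast]
    congr 1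
    field_simp
  refine Summable.of_nonneg_of_le (fun k => ?_) (fun k => ?_)
    ((summable_geometric_of_lt_one (r := x / (2 * (x + 1))) (by positivity)
      (by rw [div_lt_one hpos]; linarith)).mul_left (Real.exp A))
  · have := Real.Gamma_pos_of_pos (s := k * α + 1) (by positivity)
    positivity
  · have h := rpow_mul_exp_neg_le_Gamma (x := k * α) (by positivity) hApos
    rw [hAk] at h
    calc x ^ k / Real.Gamma (k * α + 1)
        ≤ x ^ k / ((2 * (x + 1)) ^ k * Real.exp (-A)) := by gcongr
      _ = Real.exp A * (x / (2 * (x + 1))) ^ k := by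
        rw [Real.exp_neg, div_pow]
        field_simp

lemma mittagLefflerKernel_eq_ofReal {α b t : ℝ} (hα : 0 < α) (hb : 0 ≤ b) (ht : 0 < t) :
    mittagLefflerKernel α b t =
      ENNReal.ofReal (∑' k : ℕ, (b * t ^ α) ^ k / Real.Gamma (k * α + 1)) := by
  have hΓ (k : ℕ) := Real.Gamma_pos_of_pos (s := k * α + 1) (by positivity)
  rw [ENNReal.ofReal_tsum_of_nonneg
    (fun k => div_nonneg (by positivity) (hΓ k).le)
    (summable_pow_div_Gamma hα (by positivity))]
  refine tsum_congr fun k => ?_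
  rw [powerKernel_of_pos ht, ← ENNReal.ofReal_mul (by positivity), add_sub_cancel_right,
    mul_pow, mul_div_assoc, mul_comm (k : ℝ) α, Real.rpow_mul ht.le, Real.rpow_natCast]

lemma ofReal_rlIntegral_le {α t : ℝ} (hα : 0 < α) (ψ : ℝ → ℝ) :
    ENNReal.ofReal (rlIntegral α ψ t) ≤
      ∫⁻ s in Ioo 0 t, powerKernel α (t - s) * ‖ψ s‖ₑ := by
  have hΓ := Real.Gamma_pos_of_pos hα
  rw [rlIntegral, ← integral_const_mul]
  refine (Real.ofReal_le_enorm _).trans ((enorm_integral_le_lintegral_enorm _).trans_eq ?_)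
  refine setLIntegral_congr_fun measurableSet_Ioo fun s hs => ?_
  have h2 := sub_pos.2 hs.2
  rw [← mul_assoc, enorm_mul, Real.enorm_of_nonneg (by positivity), powerKernel_of_pos h2,
    div_eq_inv_mul]

/-- The sharp fractional Grönwall inequality, with a Mittag-Leffler bound. -/
theorem le_mul_mittagLeffler {α T b ψ₀ : ℝ} (hα : 0 < α) (hb : 0 ≤ b) (hψ₀ : 0 ≤ ψ₀)
    {ψ : ℝ → ℝ} (hpos : ∀ t ∈ Icc (0 : ℝ) T, 0 ≤ ψ t)
    (hint : IntegrableOn ψ (Icc (0 : ℝ) T))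
    (hbd : ∀ t ∈ Icc (0 : ℝ) T, ψ t ≤ ψ₀ + b * rlIntegral α ψ t) {t : ℝ} (ht : t ∈ Ioc 0 T) :
    ψ t ≤ ψ₀ * ∑' k : ℕ, (b * t ^ α) ^ k / Real.Gamma (k * α + 1) := by
  have hint' : IntegrableOn ψ (Ioc 0 T) := hint.mono_set Ioc_subset_Icc_self
  set a := ENNReal.ofReal ψ₀
  set c := ENNReal.ofReal b
  set f : ℝ → ℝ≥0∞ := (Ioc 0 T).indicator fun s => ‖ψ s‖ₑ with hf
  set E := mittagLefflerKernel α b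
  have hfm : AEMeasurable f :=
    (aemeasurable_indicator_iff measurableSet_Ioc).2 hint'.aestronglyMeasurable.enorm
  have hEm : Measurable E := measurable_mittagLefflerKernel α b
  have hgm := measurable_powerKernel α
  have hff : ∫⁻ s, f s ≠ ∞ := by
    rw [hf, lintegral_indicator measurableSet_Ioc]
    exact hint'.2.ne
  have hfle (u : ℝ) (hu : u ∈ Ioc 0 T) :
      f u ≤ a + c * ∫⁻ s, powerKernel α (u - s) * f s := by
    have hu' := Ioc_subset_Icc_self hu
    calc f u = ENNReal.ofReal (ψ u) := by
          rw [hf, indicator_of_mem hu, Real.enorm_of_nonneg (hpos u hu')]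
      _ ≤ a + c * ENNReal.ofReal (rlIntegral α ψ u) := by
          refine (ENNReal.ofReal_le_ofReal (hbd u hu')).trans ?_
          rw [← ENNReal.ofReal_mul hb]
          exact ENNReal.ofReal_add_le
      _ ≤ a + c * ∫⁻ s, powerKernel α (u - s) * f s := by
          gcongr
          refine (ofReal_rlIntegral_le hα ψ).trans ?_
          rw [← lintegral_indicator measurableSet_Ioo]
          refine lintegral_mono fun s => ?_
          by_cases hs : s ∈ Ioo 0 u
          · rw [indicator_of_mem hs, hf,
              indicator_of_mem (show s ∈ Ioc 0 T from ⟨hs.1, hs.2.le.trans hu.2⟩)]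
          · rw [indicator_of_notMem hs]
            exact zero_le
  have hzero : f t - a * E t = 0 := by
    refine eq_zero_of_le_mul_lintegral_powerKernel (h := fun u => f u - a * E u) hα hb
      (hfm.sub (hEm.const_mul a).aemeasurable) (fun u hu => ?_)
      (ne_top_of_le_ne_top hff (lintegral_mono fun u => tsub_le_self)) (fun u => ?_) t
    · simp [hf, hu.not_gt]
    · by_cases hu : u ∈ Ioc 0 T
      · rw [tsub_le_iff_right]
        calc f u ≤ a + c * ∫⁻ s, powerKernel α (u - s) * f s := hfle u hu
          _ ≤ a + c * ∫⁻ s, (powerKernel α (u - s) * (f s - a * E s) +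
                a * (powerKernel α (u - s) * E s)) := by
              gcongr with s
              rw [mul_left_comm a, ← mul_add]
              gcongr
              exact le_tsub_add
          _ = c * (∫⁻ s, powerKernel α (u - s) * (f s - a * E s)) + a * E u := by
              rw [lintegral_add_right _ (by fun_prop),
                lintegral_const_mul' _ _ ENNReal.ofReal_ne_top,
                show E u = _ from mittagLefflerKernel_eq hα hb hu.1]
              ring
      · simp [hf, indicator_of_notMem hu]
  have hΓ (k : ℕ) := Real.Gamma_pos_of_pos (s := k * α + 1) (by positivity)
  have ht0 := ht.1
  have hle := tsub_eq_zero_iff_le.1 hzero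
  rwa [hf, indicator_of_mem ht, Real.enorm_of_nonneg (hpos t (Ioc_subset_Icc_self ht)),
    show E t = _ from mittagLefflerKernel_eq_ofReal hα hb ht0, ← ENNReal.ofReal_mul hψ₀,
    ENNReal.ofReal_le_ofReal_iff
      (mul_nonneg hψ₀ (tsum_nonneg fun k => div_nonneg (by positivity) (hΓ k).le))] at hle

/-- Fractional Grönwall inequality for the Riemann–Liouville integral. -/
theorem fractional_gronwall (α T : ℝ) (hα : α ∈ Ioo (0 : ℝ) 1) (hT : 0 < T)
    (ψ : ℝ → ℝ) (hpos : ∀ t ∈ Icc (0 : ℝ) T, 0 ≤ ψ t)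
    (hint : IntegrableOn ψ (Icc (0 : ℝ) T))
    (ψ₀ N₁ : ℝ) (hψ₀ : 0 ≤ ψ₀) (hN₁ : 0 ≤ N₁)
    (hbd : ∀ t ∈ Icc (0 : ℝ) T, ψ t ≤ ψ₀ + N₁ * rlIntegral α ψ t) :
    ∀ t ∈ Icc (0 : ℝ) T,
      ψ t ≤ (1 + ∑' k : ℕ, (N₁ ^ (k + 1) / Real.Gamma ((k + 1) * α)) *
          ((Real.Gamma α * t ^ α) ^ (k + 1) / ((k + 1) * α))) * ψ₀ := by
  obtain ⟨hα0, hα1⟩ := hα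
  have hΓ : 1 ≤ Real.Gamma α := by
    simpa using Real.Gamma_strictAntiOn_Ioc.antitoneOn ⟨hα0, hα1.le⟩ ⟨one_pos, le_rfl⟩ hα1.le
  intro t ht
  rcases ht.1.eq_or_lt with rfl | ht0
  · simpa [rlIntegral, Real.zero_rpow hα0.ne'] using hbd 0 ht
  have hb : 0 ≤ N₁ * Real.Gamma α := by positivity
  have hbd' (s : ℝ) (hs : s ∈ Icc 0 T) :
      ψ s ≤ ψ₀ + N₁ * Real.Gamma α * rlIntegral α ψ s := by
    have hI : 0 ≤ rlIntegral α ψ s := by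
      refine mul_nonneg (by positivity) (setIntegral_nonneg measurableSet_Ioo fun u hu => ?_)
      exact mul_nonneg (Real.rpow_nonneg (sub_nonneg.2 hu.2.le) _)
        (hpos u ⟨hu.1.le, hu.2.le.trans hs.2⟩)
    refine (hbd s hs).trans ?_
    gcongr
    exact le_mul_of_one_le_right hN₁ hΓ
  refine (le_mul_mittagLeffler hα0 hb hψ₀ hpos hint hbd' ⟨ht0, ht.2⟩).trans_eq ?_
  rw [mul_comm, (summable_pow_div_Gamma hα0 (by positivity)).tsum_eq_zero_add]
  congr 2
  · simp
  · refine tsum_congr fun k => ?_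
    have hk : ((k : ℝ) + 1) * α ≠ 0 := by positivity
    push_cast
    rw [Real.Gamma_add_one hk, div_mul_div_comm, ← mul_pow, ← mul_assoc,
      mul_comm (Real.Gamma _) (((k : ℝ) + 1) * α)]
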